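/- arXiv:1804.02917 — 6 statements merged into one kernel-verified Lean document; each statement's English description precedes it below -/
import Mathlib

section
/- If there is no pair of indices (i,j) with x i j = true and y i j = true, then for every vertex u ∈ U and every vertex v ∈ V one has dist(u,v) ≤ 2 in G(x,y). -/
/-- Vertices of the graph `G(x,y)`: four blocks of `s` vertices each
(`L`, `L'`, `R`, `R'`) plus two extra vertices `a` and `b`. -/
inductive Vtx (s : ℕ) : Type
  | L : Fin s → Vtx s
  | L' : Fin s → Vtx s
  | R : Fin s → Vtx s
  | R' : Fin s → Vtx s
  | a : Vtx s
  | b : Vtx s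
  deriving DecidableEq

/-- The base (not yet symmetrized) relation describing the edges of `G(x,y)`. -/
def baseRel {s : ℕ} (x y : Fin s → Fin s → Bool) : Vtx s → Vtx s → Prop
  | .L _, .L _ => True        -- L is a clique
  | .L' _, .L' _ => True      -- L' is a clique
  | .R _, .R _ => True        -- R is a clique
  | .R' _, .R' _ => True      -- R' is a clique
  | .L i, .R j => i = j       -- matching edges ℓ_i — r_i
  | .L' i, .R' j => i = j     -- matching edges ℓ'_i — r'_i
  | .a, .L _ => True          -- a joined to all of L
  | .a, .L' _ => True         -- a joined to all of L'
  | .b, .R _ => True          -- b joined to all of R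
  | .b, .R' _ => True         -- b joined to all of R'
  | .a, .b => True            -- the edge {a, b}
  | .L i, .L' j => x i j = false  -- input-dependent edges on Alice's side
  | .R i, .R' j => y i j = false  -- input-dependent edges on Bob's side
  | _, _ => False

/-- The graph `G(x,y)` from the proof of Theorem 14. -/
def Gxy {s : ℕ} (x y : Fin s → Fin s → Bool) : SimpleGraph (Vtx s) :=
  SimpleGraph.fromRel (baseRel x y)

/-- The set `U = L ∪ L' ∪ {a}`. -/
def Uset (s : ℕ) : Set (Vtx s) :=
  {w | (∃ i, w = .L i) ∨ (∃ i, w = .L' i) ∨ w = .a}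

/-- The set `V = R ∪ R' ∪ {b}`. -/
def Vset (s : ℕ) : Set (Vtx s) :=
  {w | (∃ i, w = .R i) ∨ (∃ i, w = .R' i) ∨ w = .b}

/-- A two-step path whose second step may be trivial bounds the distance by `2`. -/
theorem SimpleGraph.dist_le_two_of_adj_of_eq_or_adj {V : Type*} {G : SimpleGraph V} {u w v : V}
    (huw : G.Adj u w) (hwv : w = v ∨ G.Adj w v) : G.dist u v ≤ 2 := by
  rcases hwv with rfl | hwv
  · exact (SimpleGraph.dist_le huw.toWalk).trans (by simp)
  · exact SimpleGraph.dist_le (.cons huw hwv.toWalk)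

/-- If the inputs `x` and `y` are disjoint (no common index pair with value `true`),
then every vertex of `U` is at distance at most 2 from every vertex of `V` in `G(x,y)`. -/
theorem stmt_0 (s : ℕ) (hs : 1 ≤ s) (x y : Fin s → Fin s → Bool)
    (hxy : ¬ ∃ i j, x i j = true ∧ y i j = true) :
    ∀ u ∈ Uset s, ∀ v ∈ Vset s, (Gxy x y).dist u v ≤ 2 := by
  have hx_or_hy : ∀ i j, x i j = false ∨ y i j = false := by
    intro i j
    by_contra! h
    exact hxy ⟨i, j, by simpa using h⟩
  have via : ∀ {u v : Vtx s} (w : Vtx s), (Gxy x y).Adj u w → (w = v ∨ (Gxy x y).Adj w v) →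
      (Gxy x y).dist u v ≤ 2 :=
    fun _ => SimpleGraph.dist_le_two_of_adj_of_eq_or_adj
  rintro u (⟨i, rfl⟩ | ⟨i, rfl⟩ | rfl) v (⟨j, rfl⟩ | ⟨j, rfl⟩ | rfl)
  · exact via (.R i) (by simp [Gxy, baseRel]) (by simp [Gxy, baseRel, em])
  · rcases hx_or_hy i j with h | h
    · exact via (.L' j) (by simp [Gxy, baseRel, h]) (by simp [Gxy, baseRel])
    · exact via (.R i) (by simp [Gxy, baseRel]) (by simp [Gxy, baseRel, h])
  · exact via .a (by simp [Gxy, baseRel]) (by simp [Gxy, baseRel])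
  · rcases hx_or_hy j i with h | h
    · exact via (.L j) (by simp [Gxy, baseRel, h]) (by simp [Gxy, baseRel])
    · exact via (.R' i) (by simp [Gxy, baseRel]) (by simp [Gxy, baseRel, h])
  · exact via (.R' i) (by simp [Gxy, baseRel]) (by simp [Gxy, baseRel, em])
  · exact via .a (by simp [Gxy, baseRel]) (by simp [Gxy, baseRel])
  · exact via .b (by simp [Gxy, baseRel]) (by simp [Gxy, baseRel])
  · exact via .b (by simp [Gxy, baseRel]) (by simp [Gxy, baseRel])
  · exact via .b (by simp [Gxy, baseRel]) (by simp)
end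

section
/- If there exists a pair of indices (i,j) with x i j = true and y i j = true, then dist(ℓ_i, r'_j) ≥ 3 in G(x,y); in particular some vertex of U and some vertex of V are at distance at least 3. -/
/-- The path `ℓ_i, a, b, r'_j` joins `ℓ_i` to `r'_j`. -/
lemma Gxy_reachable_L_R' {s : ℕ} (x y : Fin s → Fin s → Bool) (i j : Fin s) :
    (Gxy x y).Reachable (.L i) (.R' j) := by
  have hia : (Gxy x y).Adj (.L i) .a := by simp [Gxy, baseRel]
  have hab : (Gxy x y).Adj .a .b := by simp [Gxy, baseRel]
  have hbj : (Gxy x y).Adj .b (.R' j) := by simp [Gxy, baseRel]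
  exact hia.reachable.trans (hab.reachable.trans hbj.reachable)

lemma Gxy_not_adj_L_R' {s : ℕ} (x y : Fin s → Fin s → Bool) (i j : Fin s) :
    ¬ (Gxy x y).Adj (.L i) (.R' j) := by
  simp [Gxy, baseRel]

/-- If `x i j` and `y i j` both hold, then `ℓ_i` and `r'_j` have no common neighbour. -/
lemma Gxy_not_adj_of_adj {s : ℕ} {x y : Fin s → Fin s → Bool} {i j : Fin s}
    (hx : x i j = true) (hy : y i j = true) {w : Vtx s} (h : (Gxy x y).Adj (.L i) w) :
    ¬ (Gxy x y).Adj w (.R' j) := by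
  intro h'
  cases w <;> simp_all [Gxy, baseRel]

lemma three_le_dist_L_R' {s : ℕ} {x y : Fin s → Fin s → Bool} {i j : Fin s}
    (hx : x i j = true) (hy : y i j = true) :
    3 ≤ (Gxy x y).dist (.L i) (.R' j) := by
  obtain ⟨p, hp⟩ := (Gxy_reachable_L_R' x y i j).exists_walk_length_eq_dist
  rw [← hp]
  match p with
  | .cons h .nil => exact absurd h (Gxy_not_adj_L_R' x y i j)
  | .cons h (.cons h' .nil) => exact absurd h' (Gxy_not_adj_of_adj hx hy h)
  | .cons _ (.cons _ (.cons _ _)) => simp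

/-- If the inputs `x` and `y` intersect at a pair `(i,j)`, then `ℓ_i` and `r'_j`
are at distance at least 3 in `G(x,y)`; in particular some vertex of `U` and some
vertex of `V` are at distance at least 3. -/
theorem stmt_1 (s : ℕ) (hs : 1 ≤ s) (x y : Fin s → Fin s → Bool)
    (hxy : ∃ i j, x i j = true ∧ y i j = true) :
    (∀ i j, x i j = true → y i j = true → 3 ≤ (Gxy x y).dist (.L i) (.R' j)) ∧
    ∃ u ∈ Uset s, ∃ v ∈ Vset s, 3 ≤ (Gxy x y).dist u v := by
  refine ⟨fun i j hx hy => three_le_dist_L_R' hx hy, ?_⟩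
  obtain ⟨i, j, hx, hy⟩ := hxy
  exact ⟨.L i, .inl ⟨i, rfl⟩, .R' j, .inr (.inl ⟨j, rfl⟩), three_le_dist_L_R' hx hy⟩
end

section
/- For any pair of indices (i,j), if x i j = false or y i j = false then dist(ℓ_i, r'_j) = 2 in G(x,y). -/
/-- Two distinct non-adjacent vertices with a common neighbour are at distance 2. -/
theorem SimpleGraph.dist_eq_two_of_common_neighbor {V : Type*} {G : SimpleGraph V} {u v w : V}
    (hne : u ≠ w) (hnadj : ¬ G.Adj u w) (huv : G.Adj u v) (hvw : G.Adj v w) :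
    G.dist u w = 2 := by
  have hle : G.dist u w ≤ 2 :=
    SimpleGraph.dist_le (SimpleGraph.Walk.cons huv (SimpleGraph.Walk.cons hvw .nil))
  have hpos : 0 < G.dist u w := (huv.reachable.trans hvw.reachable).pos_dist_of_ne hne
  have hone : G.dist u w ≠ 1 := fun h => hnadj (SimpleGraph.dist_eq_one_iff_adj.mp h)
  omega

/-- For any pair of indices `(i,j)`, if `x i j = false` or `y i j = false` then
the distance between `ℓ_i` and `r'_j` in `G(x,y)` is exactly 2. -/
theorem stmt_3 (s : ℕ) (hs : 1 ≤ s) (x y : Fin s → Fin s → Bool) (i j : Fin s)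
    (hxy : x i j = false ∨ y i j = false) :
    (Gxy x y).dist (.L i) (.R' j) = 2 := by
  have hnadj : ¬ (Gxy x y).Adj (.L i) (.R' j) := by simp [Gxy, baseRel]
  rcases hxy with hx | hy
  · exact SimpleGraph.dist_eq_two_of_common_neighbor (v := .L' j) (by simp) hnadj
      (by simp [Gxy, baseRel, hx]) (by simp [Gxy, baseRel])
  · exact SimpleGraph.dist_eq_two_of_common_neighbor (v := .R i) (by simp) hnadj
      (by simp [Gxy, baseRel]) (by simp [Gxy, baseRel, hy])
end

section
/- For any pair of indices (i,j), the distance dist(ℓ'_j, r_i) in G(x,y) equals 3 if x i j = true and y i j = true, and equals 2 otherwise. -/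
theorem not_adj_L'_R {s : ℕ} (x y : Fin s → Fin s → Bool) (i j : Fin s) :
    ¬ (Gxy x y).Adj (.L' j) (.R i) := by
  simp [Gxy, baseRel]

/-- The only possible common neighbours of `ℓ'_j` and `r_i` are `ℓ_i` and `r'_j`. -/
theorem eq_false_of_adj_of_adj {s : ℕ} {x y : Fin s → Fin s → Bool} {i j : Fin s} {w : Vtx s}
    (h₁ : (Gxy x y).Adj (.L' j) w) (h₂ : (Gxy x y).Adj w (.R i)) :
    x i j = false ∨ y i j = false := by
  cases w <;> simp_all [Gxy, baseRel]

theorem two_le_length_of_walk_L'_R {s : ℕ} {x y : Fin s → Fin s → Bool} {i j : Fin s}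
    (p : (Gxy x y).Walk (.L' j) (.R i)) : 2 ≤ p.length := by
  match p with
  | .cons h .nil => exact absurd h (not_adj_L'_R x y i j)
  | .cons _ (.cons _ _) => simp

theorem three_le_length_of_walk_L'_R {s : ℕ} {x y : Fin s → Fin s → Bool} {i j : Fin s}
    (hx : x i j = true) (hy : y i j = true)
    (p : (Gxy x y).Walk (.L' j) (.R i)) : 3 ≤ p.length := by
  match p with
  | .cons h .nil => exact absurd h (not_adj_L'_R x y i j)
  | .cons h₁ (.cons h₂ .nil) =>
    have := eq_false_of_adj_of_adj h₁ h₂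
    simp_all
  | .cons _ (.cons _ (.cons _ _)) => simp

theorem dist_eq_length_of_forall_le {V : Type*} {G : SimpleGraph V} {u v : V} (p : G.Walk u v)
    (h : ∀ q : G.Walk u v, p.length ≤ q.length) : G.dist u v = p.length := by
  obtain ⟨q, hq⟩ := p.reachable.exists_walk_length_eq_dist
  exact le_antisymm (SimpleGraph.dist_le p) (hq ▸ h q)

/-- For any pair of indices `(i,j)`, the distance between `ℓ'_j` and `r_i` in `G(x,y)`
is 3 if `x i j = true` and `y i j = true`, and is 2 otherwise. -/
theorem stmt_4 (s : ℕ) (hs : 1 ≤ s) (x y : Fin s → Fin s → Bool) (i j : Fin s) :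
    (x i j = true ∧ y i j = true → (Gxy x y).dist (.L' j) (.R i) = 3) ∧
    (¬ (x i j = true ∧ y i j = true) → (Gxy x y).dist (.L' j) (.R i) = 2) := by
  constructor
  · rintro ⟨hx, hy⟩
    have h₁ : (Gxy x y).Adj (.L' j) .a := by simp [Gxy, baseRel]
    have h₂ : (Gxy x y).Adj .a .b := by simp [Gxy, baseRel]
    have h₃ : (Gxy x y).Adj .b (.R i) := by simp [Gxy, baseRel]
    exact dist_eq_length_of_forall_le (.cons h₁ (.cons h₂ (.cons h₃ .nil)))
      (three_le_length_of_walk_L'_R hx hy)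
  · intro h
    obtain ⟨w, h₁, h₂⟩ : ∃ w, (Gxy x y).Adj (.L' j) w ∧ (Gxy x y).Adj w (.R i) := by
      by_cases hx : x i j = true
      · exact ⟨.R' j, by simp_all [Gxy, baseRel]⟩
      · exact ⟨.L i, by simp_all [Gxy, baseRel]⟩
    exact dist_eq_length_of_forall_le (.cons h₁ (.cons h₂ .nil)) two_le_length_of_walk_L'_R
end

section
/- For every choice of x and y, the graph G(x,y) is connected and any two of its vertices are at distance at most 3; that is, the diameter of G(x,y) is at most 3. -/
/-- The extra vertex on the same side as a given vertex: `a` on `U` and `b` on `V`. -/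
def Vtx.hub {s : ℕ} : Vtx s → Vtx s
  | .L _ | .L' _ | .a => .a
  | .R _ | .R' _ | .b => .b

theorem SimpleGraph.edist_le_one_of_ne_imp_adj {V : Type*} {G : SimpleGraph V} {u v : V}
    (h : u ≠ v → G.Adj u v) : G.edist u v ≤ 1 := by
  rcases eq_or_ne u v with rfl | huv
  · simp
  · exact (SimpleGraph.edist_eq_one_iff_adj.mpr (h huv)).le

theorem Gxy_edist_hub_le_one {s : ℕ} (x y : Fin s → Fin s → Bool) (u : Vtx s) :
    (Gxy x y).edist u u.hub ≤ 1 := by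
  apply SimpleGraph.edist_le_one_of_ne_imp_adj
  cases u <;> simp [Vtx.hub, Gxy, baseRel]

theorem Gxy_edist_hub_hub_le_one {s : ℕ} (x y : Fin s → Fin s → Bool) (u v : Vtx s) :
    (Gxy x y).edist u.hub v.hub ≤ 1 := by
  apply SimpleGraph.edist_le_one_of_ne_imp_adj
  cases u <;> cases v <;> simp [Vtx.hub, Gxy, baseRel]

theorem Gxy_edist_le_three {s : ℕ} (x y : Fin s → Fin s → Bool) (u v : Vtx s) :
    (Gxy x y).edist u v ≤ 3 :=
  calc (Gxy x y).edist u v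
      ≤ (Gxy x y).edist u v.hub + (Gxy x y).edist v.hub v := SimpleGraph.edist_triangle
    _ ≤ (Gxy x y).edist u u.hub + (Gxy x y).edist u.hub v.hub + (Gxy x y).edist v.hub v := by
      gcongr
      exact SimpleGraph.edist_triangle
    _ ≤ 1 + 1 + 1 := by
      gcongr
      · exact Gxy_edist_hub_le_one x y u
      · exact Gxy_edist_hub_hub_le_one x y u v
      · exact SimpleGraph.edist_comm.trans_le (Gxy_edist_hub_le_one x y v)
    _ = 3 := by norm_num

/-- For every choice of `x` and `y`, the graph `G(x,y)` is connected and any two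
vertices are at distance at most 3, i.e., the diameter of `G(x,y)` is at most 3. -/
theorem stmt_5 (s : ℕ) (hs : 1 ≤ s) (x y : Fin s → Fin s → Bool) :
    (Gxy x y).Connected ∧ ∀ u v : Vtx s, (Gxy x y).dist u v ≤ 3 := by
  have : Nonempty (Vtx s) := ⟨.a⟩
  refine ⟨⟨fun u v => ?_⟩, fun u v => ?_⟩
  · exact SimpleGraph.edist_ne_top_iff_reachable.mp
      (ne_top_of_le_ne_top (by decide) (Gxy_edist_le_three x y u v))
  · exact ENat.toNat_le_of_le_natCast (Gxy_edist_le_three x y u v)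
end

section
/- If there is no pair of indices (i,j) with x i j = true and y i j = true, then any two vertices of G(x,y) are at distance at most 2; that is, the diameter of G(x,y) is at most 2. -/
/-- Vertices related by `baseRel`, in either order, are at extended distance at most 1. -/
lemma edist_le_one_of_baseRel {s : ℕ} {x y : Fin s → Fin s → Bool} {u v : Vtx s}
    (h : baseRel x y u v ∨ baseRel x y v u) : (Gxy x y).edist u v ≤ 1 := by
  by_cases huv : u = v
  · simp [huv]
  · exact (SimpleGraph.edist_eq_one_iff_adj.2 ((SimpleGraph.fromRel_adj _ _ _).2 ⟨huv, h⟩)).le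

/-- A vertex related by `baseRel` to both `u` and `v` puts them at distance at most 2. -/
lemma dist_le_two_of_baseRel {s : ℕ} {x y : Fin s → Fin s → Bool} {u v : Vtx s} (w : Vtx s)
    (h₁ : baseRel x y u w ∨ baseRel x y w u) (h₂ : baseRel x y w v ∨ baseRel x y v w) :
    (Gxy x y).dist u v ≤ 2 := by
  refine ENat.toNat_le_of_le_natCast ?_
  calc (Gxy x y).edist u v ≤ (Gxy x y).edist u w + (Gxy x y).edist w v :=
        SimpleGraph.edist_triangle
    _ ≤ 1 + 1 := add_le_add (edist_le_one_of_baseRel h₁) (edist_le_one_of_baseRel h₂)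
    _ = ((2 : ℕ) : ℕ∞) := by norm_num

/-- For disjoint inputs, `ℓ_i` and `r'_j` are at distance at most 2. -/
lemma dist_L_R'_le_two {s : ℕ} {x y : Fin s → Fin s → Bool}
    (hxy : ¬ ∃ i j, x i j = true ∧ y i j = true) (i j : Fin s) :
    (Gxy x y).dist (.L i) (.R' j) ≤ 2 := by
  cases hx : x i j
  · exact dist_le_two_of_baseRel (.L' j) (by simp [baseRel, hx]) (by simp [baseRel])
  · have hy : y i j = false := Bool.eq_false_iff.2 fun hy => hxy ⟨i, j, hx, hy⟩
    exact dist_le_two_of_baseRel (.R i) (by simp [baseRel]) (by simp [baseRel, hy])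

/-- For disjoint inputs, `ℓ'_j` and `r_i` are at distance at most 2. -/
lemma dist_L'_R_le_two {s : ℕ} {x y : Fin s → Fin s → Bool}
    (hxy : ¬ ∃ i j, x i j = true ∧ y i j = true) (i j : Fin s) :
    (Gxy x y).dist (.L' j) (.R i) ≤ 2 := by
  cases hx : x i j
  · exact dist_le_two_of_baseRel (.L i) (by simp [baseRel, hx]) (by simp [baseRel])
  · have hy : y i j = false := Bool.eq_false_iff.2 fun hy => hxy ⟨i, j, hx, hy⟩
    exact dist_le_two_of_baseRel (.R' j) (by simp [baseRel]) (by simp [baseRel, hy])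

/-- If the inputs `x` and `y` are disjoint (no common index pair with value `true`),
then any two vertices of `G(x,y)` are at distance at most 2, i.e., the diameter of
`G(x,y)` is at most 2. -/
theorem stmt_6 (s : ℕ) (hs : 1 ≤ s) (x y : Fin s → Fin s → Bool)
    (hxy : ¬ ∃ i j, x i j = true ∧ y i j = true) :
    ∀ u v : Vtx s, (Gxy x y).dist u v ≤ 2 := by
  rintro (i | i | i | i | _ | _) (j | j | j | j | _ | _)
  case L.R' => exact dist_L_R'_le_two hxy i j
  case R'.L => exact SimpleGraph.dist_comm.trans_le (dist_L_R'_le_two hxy j i)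
  case L'.R => exact dist_L'_R_le_two hxy j i
  case R.L' => exact SimpleGraph.dist_comm.trans_le (dist_L'_R_le_two hxy i j)
  case a.a | b.b => simp
  case a.b | b.a =>
    exact (ENat.toNat_le_of_le_natCast (edist_le_one_of_baseRel (by simp [baseRel]))).trans one_le_two
  case L.L | L.L' | L'.L | L'.L' | L.b | L'.b | b.L | b.L' =>
    exact dist_le_two_of_baseRel .a (by simp [baseRel]) (by simp [baseRel])
  case R.R | R.R' | R'.R | R'.R' | R.a | R'.a | a.R | a.R' =>
    exact dist_le_two_of_baseRel .b (by simp [baseRel]) (by simp [baseRel])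
  case L.a =>
    exact dist_le_two_of_baseRel (.L i) (by simp [baseRel]) (by simp [baseRel])
  case L'.a =>
    exact dist_le_two_of_baseRel (.L' i) (by simp [baseRel]) (by simp [baseRel])
  case R.b | L.R =>
    exact dist_le_two_of_baseRel (.R i) (by simp [baseRel]) (by simp [baseRel])
  case R'.b | L'.R' =>
    exact dist_le_two_of_baseRel (.R' i) (by simp [baseRel]) (by simp [baseRel])
  case a.L =>
    exact dist_le_two_of_baseRel (.L j) (by simp [baseRel]) (by simp [baseRel])
  case a.L' =>
    exact dist_le_two_of_baseRel (.L' j) (by simp [baseRel]) (by simp [baseRel])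
  case b.R | R.L =>
    exact dist_le_two_of_baseRel (.R j) (by simp [baseRel]) (by simp [baseRel])
  case b.R' | R'.L' =>
    exact dist_le_two_of_baseRel (.R' j) (by simp [baseRel]) (by simp [baseRel])
end
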